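/- arXiv:2401.06689 — 10 statements merged into one kernel-verified Lean document; each statement's English description precedes it below -/
import Mathlib

section
/- Let n ≥ 1 and let t_1, …, t_n be real numbers with |t_i| > 2 for every 1 ≤ i ≤ n. Then the product matrix ∏_{i=1}^n T(t_i), taken in order, satisfies |tr(∏_{i=1}^n T(t_i))| > 2. -/
/-- For a real number `t`, `T t` is the 2×2 matrix with rows (0, −1) and (1, t). -/
noncomputable def T (t : ℝ) : Matrix (Fin 2) (Fin 2) ℝ := !![0, -1; 1, t]

/-- A matrix of determinant one mapping the half-cone `{(x, y) | |x| ≤ y}`, apart from its apex,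
into its interior: this is tested on the extreme rays through `(1, 1)` and `(-1, 1)`. -/
structure IsConeContracting (M : Matrix (Fin 2) (Fin 2) ℝ) : Prop where
  abs_add_lt : |M 0 0 + M 0 1| < M 1 1 + M 1 0
  abs_sub_lt : |M 0 0 - M 0 1| < M 1 1 - M 1 0
  det_eq_one : M 0 0 * M 1 1 - M 0 1 * M 1 0 = 1

theorem IsConeContracting.two_lt_trace {M : Matrix (Fin 2) (Fin 2) ℝ}
    (h : IsConeContracting M) : 2 < M.trace := by
  obtain ⟨hadd, hsub, hdet⟩ := h
  rw [Matrix.trace_fin_two]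
  generalize M 0 0 = p at *
  generalize M 0 1 = q at *
  generalize M 1 0 = r at *
  generalize M 1 1 = s at *
  rw [abs_lt] at hadd hsub
  have hs : 0 < s := by linarith
  have hone : 1 < (s - q) * (s + r) := by nlinarith
  have hone' : 1 < (s - r) * (s + q) := by nlinarith
  -- If `a, b < s` and `1 < a * b`, then `(s - a) * (s - b) < (s - 1) ^ 2`.
  have key : ∀ a b : ℝ, 0 < a → 0 < b → a < s → b < s → 1 < a * b →
      (s - a) * (s - b) < (s - 1) ^ 2 := by
    intro a b ha hb has hbs hab
    have hsum : 2 < a + b := by nlinarith [sq_nonneg (a - b)]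
    nlinarith [mul_pos (sub_pos.2 hbs) (sub_pos.2 hsum), sq_nonneg (b - 1)]
  have hpos : 0 < (s - 1) ^ 2 + q * r := by
    rcases lt_trichotomy (q * r) 0 with hqr | hqr | hqr
    · rcases mul_neg_iff.1 hqr with ⟨hq0, hr0⟩ | ⟨hq0, hr0⟩
      · nlinarith [key (s - q) (s + r) (by linarith) (by linarith) (by linarith)
          (by linarith) hone]
      · nlinarith [key (s - r) (s + q) (by linarith) (by linarith) (by linarith)
          (by linarith) hone']
    · have hs1 : 1 < s := by
        rcases mul_eq_zero.1 hqr with h0 | h0 <;> subst h0 <;> nlinarith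
      rw [hqr]
      nlinarith
    · positivity
  by_contra! hle
  nlinarith

theorem isConeContracting_T {t : ℝ} (ht : 2 < t) : IsConeContracting (T t) := by
  constructor <;> simp [T] <;> linarith

theorem isConeContracting_neg_T {t : ℝ} (ht : t < -2) : IsConeContracting (-T t) := by
  constructor <;> simp [T] <;> linarith

theorem IsConeContracting.T_mul {M : Matrix (Fin 2) (Fin 2) ℝ} (h : IsConeContracting M)
    {t : ℝ} (ht : 2 < t) : IsConeContracting (T t * M) := by
  obtain ⟨hadd, hsub, hdet⟩ := h
  rw [abs_lt] at hadd hsub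
  constructor <;> simp only [T, abs_lt, Matrix.mul_apply, Fin.sum_univ_two, Matrix.of_apply,
    Matrix.cons_val', Matrix.cons_val_zero, Matrix.cons_val_one, Matrix.cons_val_fin_one]
  case det_eq_one => linear_combination hdet
  all_goals constructor <;> nlinarith

theorem IsConeContracting.neg_T_mul {M : Matrix (Fin 2) (Fin 2) ℝ} (h : IsConeContracting M)
    {t : ℝ} (ht : t < -2) : IsConeContracting (-(T t * M)) := by
  obtain ⟨hadd, hsub, hdet⟩ := h
  rw [abs_lt] at hadd hsub
  constructor <;> simp only [T, abs_lt, Matrix.neg_apply, Matrix.mul_apply, Fin.sum_univ_two,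
    Matrix.of_apply, Matrix.cons_val', Matrix.cons_val_zero, Matrix.cons_val_one,
    Matrix.cons_val_fin_one]
  case det_eq_one => linear_combination hdet
  all_goals constructor <;> nlinarith

theorem isConeContracting_prod_or_neg (l : List ℝ) (hne : l ≠ []) (hl : ∀ t ∈ l, 2 < |t|) :
    IsConeContracting (l.map T).prod ∨ IsConeContracting (-(l.map T).prod) := by
  induction l with
  | nil => exact absurd rfl hne
  | cons t l ih =>
    have ht : t < -2 ∨ 2 < t := by
      rcases lt_abs.1 (hl t (by simp)) with h | h
      · exact Or.inr h
      · exact Or.inl (by linarith)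
    rcases eq_or_ne l [] with rfl | hl'
    · rcases ht with ht | ht
      · exact Or.inr (by simpa using isConeContracting_neg_T ht)
      · exact Or.inl (by simpa using isConeContracting_T ht)
    · rw [List.map_cons, List.prod_cons]
      rcases ih hl' (fun x hx => hl x (List.mem_cons_of_mem t hx)) with h | h <;>
        rcases ht with ht | ht
      · exact Or.inr (h.neg_T_mul ht)
      · exact Or.inl (h.T_mul ht)
      · exact Or.inl (by simpa using h.neg_T_mul ht)
      · exact Or.inr (by simpa using h.T_mul ht)

/-- **Main theorem.** If `|t i| > 2` for every `i`, then the ordered product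
`∏_{i=1}^n T(t_i)` has trace larger than 2 in absolute value. -/
theorem trace_prod_gt_two (n : ℕ) (hn : 1 ≤ n) (t : Fin n → ℝ)
    (ht : ∀ i : Fin n, |t i| > 2) :
    |Matrix.trace ((List.ofFn fun i : Fin n => T (t i)).prod)| > 2 := by
  have hmap : (List.ofFn fun i : Fin n => T (t i)) = (List.ofFn t).map T := by
    rw [List.map_ofFn]; rfl
  have hne : List.ofFn t ≠ [] := by
    rw [Ne, List.ofFn_eq_nil_iff]; omega
  have hmem : ∀ x ∈ List.ofFn t, 2 < |x| := by
    intro x hx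
    obtain ⟨i, rfl⟩ := (List.mem_ofFn' t x).1 hx
    exact ht i
  rw [hmap, gt_iff_lt, lt_abs]
  rcases isConeContracting_prod_or_neg _ hne hmem with h | h
  · exact Or.inl h.two_lt_trace
  · exact Or.inr (by simpa using h.two_lt_trace)
end

section
/- Let n ≥ 1 and let t_1, …, t_n be real numbers with |t_i| > 2 for every 1 ≤ i ≤ n, and set Π = ∏_{i=1}^n T(t_i). Then the (2,2) entry of Π dominates both off-diagonal entries: |Π₂₂| > |Π₁₂| + 1 and |Π₂₂| > |Π₂₁| + 1. Equivalently, with e₁ = (1,0)ᵀ and e₂ = (0,1)ᵀ, one has |e₂ᵀ Π e₂| > |e₁ᵀ Π e₂| + 1 and |e₂ᵀ Π e₂| > |e₂ᵀ Π e₁| + 1. -/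
/-- The scalar growth step: the recurrence `(b, a) ↦ (a, b + t * a)` with `|t| > 2` turns weak
dominance of `a` over `b` into strict dominance. -/
theorem abs_add_one_lt_abs_add_mul {a b t : ℝ} (ht : 2 < |t|) (h : |b| + 1 ≤ |a|) :
    |a| + 1 < |b + t * a| := by
  have hsub : |t * a| - |b| ≤ |b + t * a| := by
    simpa [add_comm] using abs_sub_abs_le_abs_sub (t * a) (-b)
  rw [abs_mul] at hsub
  nlinarith [abs_nonneg b]

theorem T_mul_zero_one (t : ℝ) (M : Matrix (Fin 2) (Fin 2) ℝ) : (T t * M) 0 1 = -M 1 1 := by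
  simp [T, Matrix.mul_apply, Fin.sum_univ_two]

theorem T_mul_one_one (t : ℝ) (M : Matrix (Fin 2) (Fin 2) ℝ) :
    (T t * M) 1 1 = M 0 1 + t * M 1 1 := by
  simp [T, Matrix.mul_apply, Fin.sum_univ_two]

theorem mul_T_one_zero (t : ℝ) (M : Matrix (Fin 2) (Fin 2) ℝ) : (M * T t) 1 0 = M 1 1 := by
  simp [T, Matrix.mul_apply, Fin.sum_univ_two]

theorem mul_T_one_one (t : ℝ) (M : Matrix (Fin 2) (Fin 2) ℝ) :
    (M * T t) 1 1 = -M 1 0 + t * M 1 1 := by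
  simp [T, Matrix.mul_apply, Fin.sum_univ_two, mul_comm]

theorem abs_prod_T_zero_one_lt (l : List ℝ) (hl : ∀ t ∈ l, 2 < |t|) (hne : l ≠ []) :
    |(l.map T).prod 0 1| + 1 < |(l.map T).prod 1 1| := by
  induction l with
  | nil => exact absurd rfl hne
  | cons t l ih =>
    rw [List.map_cons, List.prod_cons, T_mul_zero_one, T_mul_one_one, abs_neg]
    refine abs_add_one_lt_abs_add_mul (hl t (by simp)) ?_
    rcases eq_or_ne l [] with rfl | h
    · simp
    · exact (ih (fun s hs => hl s (by simp [hs])) h).le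

theorem abs_prod_T_one_zero_lt (l : List ℝ) (hl : ∀ t ∈ l, 2 < |t|) (hne : l ≠ []) :
    |(l.map T).prod 1 0| + 1 < |(l.map T).prod 1 1| := by
  induction l using List.reverseRecOn with
  | nil => exact absurd rfl hne
  | append_singleton l t ih =>
    rw [List.map_append, List.prod_append, List.map_singleton, List.prod_singleton,
      mul_T_one_zero, mul_T_one_one]
    refine abs_add_one_lt_abs_add_mul (hl t (by simp)) ?_
    rw [abs_neg]
    rcases eq_or_ne l [] with rfl | h
    · simp
    · exact (ih (fun s hs => hl s (by simp [hs])) h).le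

/-- **Entrywise growth lemma.** If `|t i| > 2` for every `i`, then the (2,2) entry of
the ordered product `Π = ∏_{i=1}^n T(t_i)` dominates both off-diagonal entries:
`|Π₂₂| > |Π₁₂| + 1` and `|Π₂₂| > |Π₂₁| + 1`. -/
theorem entry_growth (n : ℕ) (hn : 1 ≤ n) (t : Fin n → ℝ)
    (ht : ∀ i : Fin n, |t i| > 2) :
    |((List.ofFn fun i : Fin n => T (t i)).prod) 1 1| >
      |((List.ofFn fun i : Fin n => T (t i)).prod) 0 1| + 1 ∧
    |((List.ofFn fun i : Fin n => T (t i)).prod) 1 1| >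
      |((List.ofFn fun i : Fin n => T (t i)).prod) 1 0| + 1 := by
  have hmap : (List.ofFn fun i : Fin n => T (t i)) = (List.ofFn t).map T := by
    rw [List.map_ofFn, Function.comp_def]
  have hl : ∀ s ∈ List.ofFn t, 2 < |s| := by
    simpa [List.mem_ofFn] using ht
  have hne : List.ofFn t ≠ [] := by
    rw [Ne, List.ofFn_eq_nil_iff]
    omega
  rw [hmap]
  exact ⟨abs_prod_T_zero_one_lt _ hl hne, abs_prod_T_one_zero_lt _ hl hne⟩
end

section
/- Let n ≥ 1 and let t_1, …, t_n be real numbers with |t_i| > 2 for every 1 ≤ i ≤ n. Then the product matrix Π = ∏_{i=1}^n T(t_i), regarded as a complex matrix, has no eigenvalue of unit modulus: for every real θ, det(Π − e^{iθ}·I) ≠ 0. Consequently the Floquet–Bloch dispersion relation 2·cos(n·k) = (−1)^n·tr Π has no real solution k. -/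
open Complex

theorem abs_T_prod_zero_one_add_one_le (l : List ℝ) (hl : ∀ x ∈ l, 2 < |x|) :
    |(l.map T).prod 0 1| + 1 ≤ |(l.map T).prod 1 1| := by
  induction l with
  | nil => simp
  | cons x l ih =>
    have hx := hl x (by simp)
    have ih := ih fun y hy => hl y (by simp [hy])
    simp only [List.map_cons, List.prod_cons]
    generalize (l.map T).prod = M at ih ⊢
    simp only [T, Matrix.mul_apply, Fin.sum_univ_two, Matrix.of_apply,
      Matrix.cons_val', Matrix.cons_val_zero, Matrix.cons_val_one, Matrix.cons_val_fin_one,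
      zero_mul, one_mul, neg_mul, zero_add, abs_neg]
    have h := abs_sub_abs_le_abs_sub (x * M 1 1) (-M 0 1)
    rw [abs_mul, abs_neg, sub_neg_eq_add, add_comm (x * M 1 1)] at h
    nlinarith [abs_nonneg (M 1 1)]

theorem abs_T_prod_one_zero_add_one_le (l : List ℝ) (hl : ∀ x ∈ l, 2 < |x|) :
    |(l.map T).prod 1 0| + 1 ≤ |(l.map T).prod 1 1| := by
  induction l using List.reverseRecOn with
  | nil => simp
  | append_singleton l x ih =>
    have hx := hl x (by simp)
    have ih := ih fun y hy => hl y (by simp [hy])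
    simp only [List.map_append, List.prod_append, List.map_cons, List.map_nil, List.prod_singleton]
    generalize (l.map T).prod = M at ih ⊢
    simp only [T, Matrix.mul_apply, Fin.sum_univ_two, Matrix.of_apply,
      Matrix.cons_val', Matrix.cons_val_zero, Matrix.cons_val_one, Matrix.cons_val_fin_one,
      mul_zero, mul_one, mul_neg, zero_add]
    have h := abs_sub_abs_le_abs_sub (M 1 1 * x) (M 1 0)
    rw [abs_mul, sub_eq_add_neg (M 1 1 * x), add_comm (M 1 1 * x)] at h
    nlinarith [abs_nonneg (M 1 1)]

theorem two_lt_abs_trace_T_prod (l : List ℝ) (hne : l ≠ []) (hl : ∀ x ∈ l, 2 < |x|) :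
    2 < |(l.map T).prod.trace| := by
  obtain ⟨x, l, rfl⟩ := List.exists_cons_of_ne_nil hne
  have hx := hl x (by simp)
  have hl' : ∀ y ∈ l, 2 < |y| := fun y hy => hl y (by simp [hy])
  have hrow := abs_T_prod_zero_one_add_one_le l hl'
  have hcol := abs_T_prod_one_zero_add_one_le l hl'
  simp only [List.map_cons, List.prod_cons]
  generalize (l.map T).prod = M at hrow hcol ⊢
  simp only [T, Matrix.trace_fin_two, Matrix.mul_apply, Fin.sum_univ_two, Matrix.of_apply,
    Matrix.cons_val', Matrix.cons_val_zero, Matrix.cons_val_one, Matrix.cons_val_fin_one,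
    zero_mul, one_mul, neg_mul, zero_add]
  have h := abs_sub_abs_le_abs_sub (x * M 1 1) (M 1 0 - M 0 1)
  have h' := abs_sub (M 1 0) (M 0 1)
  rw [abs_mul, show x * M 1 1 - (M 1 0 - M 0 1) = -M 1 0 + (M 0 1 + x * M 1 1) by ring] at h
  nlinarith [abs_nonneg (M 1 1), abs_nonneg (M 0 1)]

theorem det_T_prod (l : List ℝ) : (l.map T).prod.det = 1 := by
  induction l with
  | nil => simp
  | cons x l ih =>
    rw [List.map_cons, List.prod_cons, Matrix.det_mul, ih, T, Matrix.det_fin_two_of]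
    ring

/-- A real unimodular 2×2 matrix with an eigenvalue `e^{iθ}` has trace `2 cos θ`. -/
theorem trace_eq_two_mul_cos_of_det_sub_exp_eq_zero {M : Matrix (Fin 2) (Fin 2) ℝ}
    (hM : M.det = 1) {θ : ℝ}
    (h : (M.map Complex.ofReal
      - Complex.exp (θ * Complex.I) • (1 : Matrix (Fin 2) (Fin 2) ℂ)).det = 0) :
    M.trace = 2 * Real.cos θ := by
  have hM' : (M 0 0 : ℂ) * M 1 1 - M 0 1 * M 1 0 = 1 := by
    rw [Matrix.det_fin_two] at hM
    exact_mod_cast hM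
  have hexp : Complex.exp (θ * Complex.I) * Complex.exp (-θ * Complex.I) = 1 := by
    rw [← Complex.exp_add]
    simp
  simp only [Matrix.det_fin_two, Matrix.sub_apply, Matrix.map_apply, Matrix.smul_apply,
    Matrix.one_apply_eq, ne_eq, zero_ne_one, one_ne_zero, not_false_eq_true,
    Matrix.one_apply_ne, smul_eq_mul, mul_one, mul_zero, sub_zero] at h
  have key : (M.trace : ℂ) = 2 * Complex.cos θ := by
    rw [Complex.two_cos, Matrix.trace_fin_two]
    push_cast
    generalize Complex.exp (θ * Complex.I) = z at h hexp ⊢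
    generalize Complex.exp (-θ * Complex.I) = w at hexp ⊢
    linear_combination (-w) * h + w * hM' + (z - M 0 0 - M 1 1) * hexp
  exact_mod_cast key

/-- If `|t i| > 2` for every `i`, then the product `Π = ∏_{i=1}^n T(t_i)`, regarded as a
complex matrix, has no eigenvalue of unit modulus `e^{iθ}`; consequently the dispersion
relation `2·cos(n·k) = (−1)^n·tr Π` has no real solution `k`. -/
theorem no_unit_eigenvalue_of_all_gap (n : ℕ) (hn : 1 ≤ n) (t : Fin n → ℝ)
    (ht : ∀ i : Fin n, |t i| > 2) :
    (∀ θ : ℝ, ((((List.ofFn fun i : Fin n => T (t i)).prod).map Complex.ofReal)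
        - Complex.exp (θ * Complex.I) • (1 : Matrix (Fin 2) (Fin 2) ℂ)).det ≠ 0) ∧
    ¬ ∃ k : ℝ, 2 * Real.cos (n * k)
        = (-1 : ℝ) ^ n * Matrix.trace ((List.ofFn fun i : Fin n => T (t i)).prod) := by
  have hprod : (List.ofFn fun i : Fin n => T (t i)).prod = ((List.ofFn t).map T).prod := by
    rw [List.map_ofFn, Function.comp_def]
  have htr : 2 < |((List.ofFn t).map T).prod.trace| := by
    refine two_lt_abs_trace_T_prod _ ?_ ?_
    · rw [ne_eq, List.ofFn_eq_nil_iff]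
      lia
    · intro x hx
      obtain ⟨i, rfl⟩ := List.mem_ofFn.mp hx
      exact ht i
  have hcos (x : ℝ) : |2 * Real.cos x| ≤ 2 := by
    rw [abs_mul, abs_two]
    linarith [Real.abs_cos_le_one x]
  rw [hprod]
  refine ⟨fun θ h => ?_, fun ⟨k, hk⟩ => ?_⟩
  · rw [trace_eq_two_mul_cos_of_det_sub_exp_eq_zero (det_T_prod _) h] at htr
    exact htr.not_ge (hcos θ)
  · have h := hcos (n * k)
    rw [hk, abs_mul, abs_neg_one_pow, one_mul] at h
    exact htr.not_ge h
end

section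
/- Let n ≥ 1, let t_1, …, t_n : ℝ → ℝ be functions, and let a < b be real numbers such that |t_i(ω)| > 2 for every ω ∈ (a, b) and every 1 ≤ i ≤ n. Then (a, b) is a hierarchical band gap: for every ω ∈ (a, b) one has both |tr T(t_i(ω))| > 2 for all 1 ≤ i ≤ n and |tr(∏_{i=1}^n T(t_i(ω)))| > 2. -/
/-- A matrix of determinant one whose lower right entry exceeds each off-diagonal entry by at
least one in absolute value. -/
structure IsCornerDominant (M : Matrix (Fin 2) (Fin 2) ℝ) : Prop where
  det_eq_one : M 0 0 * M 1 1 - M 0 1 * M 1 0 = 1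
  upper_right : |M 0 1| + 1 ≤ |M 1 1|
  lower_left : |M 1 0| + 1 ≤ |M 1 1|

theorem isCornerDominant_one : IsCornerDominant 1 := by
  constructor <;> simp

theorem T_mul (x : ℝ) (M : Matrix (Fin 2) (Fin 2) ℝ) :
    T x * M = !![-M 1 0, -M 1 1; M 0 0 + x * M 1 0, M 0 1 + x * M 1 1] := by
  ext i j
  fin_cases i <;> fin_cases j <;> simp [T, Matrix.mul_apply, Fin.sum_univ_two]

theorem two_mul_abs_sub_abs_lt {x q s : ℝ} (hx : 2 < |x|) (hs : 0 < |s|) :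
    2 * |s| - |q| < |q + x * s| := by
  have h₁ : |x * s| - |q| ≤ |q + x * s| := by
    simpa [add_comm] using abs_sub_abs_le_abs_sub (x * s) (-q)
  rw [abs_mul] at h₁
  nlinarith

theorem IsCornerDominant.T_mul {x : ℝ} (hx : 2 < |x|) {M : Matrix (Fin 2) (Fin 2) ℝ}
    (hM : IsCornerDominant M) : IsCornerDominant (T x * M) := by
  obtain ⟨hdet, hq, hr⟩ := hM
  have hs : 0 < |M 1 1| := by linarith [abs_nonneg (M 0 1)]
  have hlt := two_mul_abs_sub_abs_lt (q := M 0 1) hx hs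
  rw [_root_.T_mul]
  constructor
  · simp
    linear_combination hdet
  · simp
    linarith
  · simp
    have hmul : (M 0 0 + x * M 1 0) * M 1 1 = 1 + M 1 0 * (M 0 1 + x * M 1 1) := by
      linear_combination hdet
    have habs : |M 0 0 + x * M 1 0| * |M 1 1| ≤ 1 + |M 1 0| * |M 0 1 + x * M 1 1| := by
      rw [← abs_mul, ← abs_mul, hmul]
      simpa using abs_add_le 1 (M 1 0 * (M 0 1 + x * M 1 1))
    refine le_of_mul_le_mul_right ?_ hs
    nlinarith [mul_le_mul_of_nonneg_right hr (abs_nonneg (M 0 1 + x * M 1 1))]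

theorem IsCornerDominant.two_lt_abs_trace_T_mul {x : ℝ} (hx : 2 < |x|)
    {M : Matrix (Fin 2) (Fin 2) ℝ} (hM : IsCornerDominant M) :
    2 < |Matrix.trace (T x * M)| := by
  obtain ⟨-, hq, hr⟩ := hM
  have hs : 0 < |M 1 1| := by linarith [abs_nonneg (M 0 1)]
  have hlt := two_mul_abs_sub_abs_lt (q := M 0 1) hx hs
  have htrace : Matrix.trace (T x * M) = M 0 1 + x * M 1 1 - M 1 0 := by
    rw [_root_.T_mul, Matrix.trace_fin_two_of]
    ring
  rw [htrace]
  linarith [abs_sub_abs_le_abs_sub (M 0 1 + x * M 1 1) (M 1 0)]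

theorem isCornerDominant_prod_map_T {l : List ℝ} (hl : ∀ x ∈ l, 2 < |x|) :
    IsCornerDominant (l.map T).prod := by
  induction l with
  | nil => simpa using isCornerDominant_one
  | cons x l ih =>
    rw [List.forall_mem_cons] at hl
    simpa using (ih hl.2).T_mul hl.1

theorem two_lt_abs_trace_prod_map_T {l : List ℝ} (hne : l ≠ []) (hl : ∀ x ∈ l, 2 < |x|) :
    2 < |Matrix.trace (l.map T).prod| := by
  obtain ⟨x, l, rfl⟩ := List.exists_cons_of_ne_nil hne
  rw [List.forall_mem_cons] at hl
  simpa using (isCornerDominant_prod_map_T hl.2).two_lt_abs_trace_T_mul hl.1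

/-- **Hierarchical band gaps.** If `|t_i(ω)| > 2` for every `ω ∈ (a, b)` and every `i`,
then `(a, b)` is a hierarchical band gap: for all `ω ∈ (a, b)` both
`|tr T(t_i(ω))| > 2` for each `i` and `|tr ∏ T(t_i(ω))| > 2`. -/
theorem hierarchical_band_gap (n : ℕ) (hn : 1 ≤ n) (t : Fin n → ℝ → ℝ)
    (a b : ℝ) (hab : a < b)
    (ht : ∀ ω ∈ Set.Ioo a b, ∀ i : Fin n, |t i ω| > 2) :
    ∀ ω ∈ Set.Ioo a b,
      (∀ i : Fin n, |Matrix.trace (T (t i ω))| > 2) ∧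
      |Matrix.trace ((List.ofFn fun i : Fin n => T (t i ω)).prod)| > 2 := by
  intro ω hω
  refine ⟨fun i => by simpa [T, Matrix.trace_fin_two_of] using ht ω hω i, ?_⟩
  have hprod := two_lt_abs_trace_prod_map_T (l := List.ofFn fun i => t i ω)
    (by simpa [List.ofFn_eq_nil_iff] using Nat.one_le_iff_ne_zero.mp hn)
    (by simpa [List.mem_ofFn] using ht ω hω)
  rwa [List.map_ofFn] at hprod
end

section
/- Let n ≥ 1, let m_1, …, m_n be positive reals, let κ > 0, and let ω be a real number with ω² > 4κ/m_i for every 1 ≤ i ≤ n (equivalently ω² > 4κ/(min_i m_i)). Then |tr(∏_{i=1}^n T(ω²·m_i/κ − 2))| > 2, i.e. ω lies in a band gap of the complex periodic mass-spring chain with unit cell (m_1, …, m_n). -/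
/-- In the basis `(-e₀ + e₁, e₁)`, a product of matrices `T t` with `2 ≤ t` has nonnegative
entries and diagonal entries at least one. -/
lemma list_prod_T_entry_bounds (l : List ℝ) (hl : ∀ t ∈ l, 2 ≤ t) :
    let P := (l.map T).prod
    1 ≤ P 0 0 - P 0 1 ∧ 0 ≤ -P 0 1 ∧ 0 ≤ P 0 1 + P 1 1 - P 0 0 - P 1 0 ∧
      1 ≤ P 0 1 + P 1 1 := by
  induction l with
  | nil => simp
  | cons t l ih =>
    obtain ⟨hA, hB, hC, hD⟩ := ih fun s hs => hl s (List.mem_cons_of_mem _ hs)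
    have ht : 0 ≤ t - 2 := sub_nonneg.2 (hl t List.mem_cons_self)
    simp only [List.map_cons, List.prod_cons]
    generalize (l.map T).prod = P at *
    simp only [T, Matrix.mul_apply, Fin.sum_univ_two, Matrix.of_apply, Matrix.cons_val_zero,
      Matrix.cons_val_one]
    refine ⟨?_, ?_, ?_, ?_⟩ <;>
      nlinarith [mul_nonneg ht hB, mul_nonneg ht hC, mul_nonneg ht (sub_nonneg.2 hA),
        mul_nonneg ht (sub_nonneg.2 hD)]

/-- A nonempty product of matrices `T t` with `2 < t` has trace greater than two. -/
lemma two_lt_trace_list_prod_T (l : List ℝ) (hne : l ≠ []) (hl : ∀ t ∈ l, 2 < t) :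
    2 < Matrix.trace (l.map T).prod := by
  cases l with
  | nil => exact absurd rfl hne
  | cons t l =>
    obtain ⟨hA, hB, hC, hD⟩ :=
      list_prod_T_entry_bounds l fun s hs => (hl s (List.mem_cons_of_mem _ hs)).le
    have ht : 0 < t - 2 := sub_pos.2 (hl t List.mem_cons_self)
    simp only [List.map_cons, List.prod_cons]
    generalize (l.map T).prod = P at *
    simp only [T, Matrix.trace_fin_two, Matrix.mul_apply, Fin.sum_univ_two, Matrix.of_apply,
      Matrix.cons_val_zero, Matrix.cons_val_one]
    nlinarith [mul_nonneg ht.le hB, mul_nonneg ht.le (sub_nonneg.2 hD)]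

/-- **High-frequency hierarchical band gap of the mass-spring chain.** If
`ω² > 4κ/m_i` for every `i`, then the trace of the product of the per-site transfer
matrices `T(ω²·m_i/κ − 2)` exceeds 2 in absolute value. -/
theorem mass_spring_hierarchical_gap (n : ℕ) (hn : 1 ≤ n) (m : Fin n → ℝ)
    (hm : ∀ i : Fin n, m i > 0) (κ : ℝ) (hκ : κ > 0) (ω : ℝ)
    (hω : ∀ i : Fin n, ω ^ 2 > 4 * κ / m i) :
    |Matrix.trace ((List.ofFn fun i : Fin n => T (ω ^ 2 * m i / κ - 2)).prod)| > 2 := by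
  have key := two_lt_trace_list_prod_T (List.ofFn fun i => ω ^ 2 * m i / κ - 2)
    (by simpa [List.ofFn_eq_nil_iff] using Nat.one_le_iff_ne_zero.1 hn) (by
      intro t ht
      obtain ⟨i, rfl⟩ := List.mem_ofFn.1 ht
      have h : 4 < ω ^ 2 * m i / κ := (lt_div_iff₀ hκ).2 ((div_lt_iff₀ (hm i)).1 (hω i))
      linarith)
  rw [List.map_ofFn] at key
  exact key.trans_le (le_abs_self _)
end

section
/- Every periodic mass-spring chain exhibits a band gap at sufficiently high frequencies: for every n ≥ 1, positive masses m_1, …, m_n and κ > 0, there exists Ω > 0 (one may take Ω = 4κ/(min_i m_i)) such that for all real ω with ω² > Ω, |tr(∏_{i=1}^n T(ω²·m_i/κ − 2))| > 2. -/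
/-- Entrywise inequalities satisfied by every product of matrices `T t` with `t > 2`. -/
theorem entries_prod_transfer {l : List ℝ} (hl : ∀ t ∈ l, 2 < t) :
    let M := (l.map T).prod
    1 ≤ M 1 1 - M 1 0 ∧ 1 ≤ M 1 1 + M 0 1 ∧
      0 ≤ M 1 1 - M 1 0 + (M 0 1 - M 0 0) ∧ 0 < M 1 1 := by
  induction l with
  | nil => simp
  | cons t l ih =>
    have ht : 2 < t := hl t (by simp)
    obtain ⟨h₁, h₂, h₃, h₄⟩ := ih fun s hs => hl s (by simp [hs])
    simp only [List.map_cons, List.prod_cons]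
    generalize (l.map T).prod = M at *
    simp only [T, Matrix.mul_apply, Fin.sum_univ_two, Matrix.of_apply, Matrix.cons_val_zero,
      Matrix.cons_val_one, Matrix.cons_val', Matrix.cons_val_fin_one]
    refine ⟨?_, ?_, ?_, ?_⟩ <;>
      nlinarith [mul_pos (sub_pos.2 ht) h₄,
        mul_nonneg (sub_pos.2 ht).le (sub_nonneg.2 h₁)]

/-- A nonempty product of matrices `T t` with `t > 2` is hyperbolic with trace above `2`. -/
theorem two_lt_trace_prod_transfer {l : List ℝ} (hne : l ≠ []) (hl : ∀ t ∈ l, 2 < t) :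
    2 < ((l.map T).prod).trace := by
  cases l with
  | nil => exact absurd rfl hne
  | cons t l =>
    have ht : 2 < t := hl t (by simp)
    obtain ⟨h₁, h₂, -, h₄⟩ := entries_prod_transfer (l := l) fun s hs => hl s (by simp [hs])
    simp only [List.map_cons, List.prod_cons]
    generalize (l.map T).prod = M at *
    simp only [T, Matrix.trace_fin_two, Matrix.mul_apply, Fin.sum_univ_two, Matrix.of_apply,
      Matrix.cons_val_zero, Matrix.cons_val_one, Matrix.cons_val', Matrix.cons_val_fin_one]
    nlinarith [mul_pos (sub_pos.2 ht) h₄]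

/-- **High-frequency band gap.** Every periodic mass-spring chain exhibits a band gap at
sufficiently high frequencies: there exists `Ω > 0` such that for all `ω` with `ω² > Ω`,
the trace of the product of transfer matrices across the unit cell exceeds 2 in
absolute value. -/
theorem mass_spring_high_frequency_gap (n : ℕ) (hn : 1 ≤ n) (m : Fin n → ℝ)
    (hm : ∀ i : Fin n, m i > 0) (κ : ℝ) (hκ : κ > 0) :
    ∃ Ω > 0, ∀ ω : ℝ, ω ^ 2 > Ω →
      |Matrix.trace ((List.ofFn fun i : Fin n => T (ω ^ 2 * m i / κ - 2)).prod)| > 2 := by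
  have : Nonempty (Fin n) := ⟨⟨0, hn⟩⟩
  obtain ⟨j, hj⟩ := Finite.exists_min m
  refine ⟨4 * κ / m j, div_pos (by positivity) (hm j), fun ω hω => ?_⟩
  have hl : ∀ t ∈ List.ofFn fun i : Fin n => ω ^ 2 * m i / κ - 2, 2 < t := by
    intro t ht
    obtain ⟨i, rfl⟩ := (List.mem_ofFn' _ _).1 ht
    have hmj : 4 * κ < ω ^ 2 * m j := (div_lt_iff₀ (hm j)).1 hω
    have hmi : ω ^ 2 * m j ≤ ω ^ 2 * m i := mul_le_mul_of_nonneg_left (hj i) (sq_nonneg ω)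
    have : 4 < ω ^ 2 * m i / κ := (lt_div_iff₀ hκ).2 (hmj.trans_le hmi)
    linarith
  have htr := two_lt_trace_prod_transfer
    (by rw [Ne, List.ofFn_eq_nil_iff]; omega) hl
  rw [List.map_ofFn] at htr
  exact htr.trans_le (le_abs_self _)
end

section
/- Let n ≥ 1, let m_1, …, m_n be positive reals, let κ > 0 and ω₀ ∈ ℝ, and suppose the real number ω satisfies either ω² < ω₀² or ω² > ω₀² + 4κ/(min_i m_i). Let P_i be the 2×2 matrix with rows (0, 1) and (−1, 2 − ω²·m_i/κ + ω₀²·m_i/κ). Then |tr(∏_{i=1}^n P_i)| > 2, i.e. ω lies in a band gap of the complex periodic chain of identical pendulums attached to the modulated masses m_1, …, m_n. -/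
/-- The transfer matrix with rows `(0, 1)` and `(-1, t)`. -/
def transferMatrix (t : ℝ) : Matrix (Fin 2) (Fin 2) ℝ := !![0, 1; -1, t]

/-- In the basis `(1, 1), (0, 1)` a product of transfer matrices with parameters at least `2` has
nonnegative entries and diagonal entries at least `1`. -/
lemma transferMatrix_prod_entry_bounds (l : List ℝ) (hl : ∀ t ∈ l, 2 ≤ t) :
    1 ≤ (l.map transferMatrix).prod 0 0 + (l.map transferMatrix).prod 0 1 ∧
    0 ≤ (l.map transferMatrix).prod 0 1 ∧
    (l.map transferMatrix).prod 0 0 + (l.map transferMatrix).prod 0 1 ≤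
      (l.map transferMatrix).prod 1 0 + (l.map transferMatrix).prod 1 1 ∧
    1 ≤ (l.map transferMatrix).prod 1 1 - (l.map transferMatrix).prod 0 1 := by
  induction l with
  | nil => simp
  | cons t l ih =>
    obtain ⟨h₁, h₂, h₃, h₄⟩ := ih fun s hs => hl s (List.mem_cons_of_mem t hs)
    have ht : 2 ≤ t := hl t List.mem_cons_self
    simp only [List.map_cons, List.prod_cons]
    generalize (l.map transferMatrix).prod = M at *
    simp [transferMatrix, Matrix.mul_apply, Fin.sum_univ_two]
    refine ⟨?_, ?_, ?_, ?_⟩ <;> nlinarith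

lemma two_lt_trace_transferMatrix_prod (l : List ℝ) (hne : l ≠ []) (hl : ∀ t ∈ l, 2 < t) :
    2 < (l.map transferMatrix).prod.trace := by
  cases l with
  | nil => exact absurd rfl hne
  | cons t l =>
    obtain ⟨h₁, h₂, h₃, h₄⟩ := transferMatrix_prod_entry_bounds l
      fun s hs => (hl s (List.mem_cons_of_mem t hs)).le
    have ht : 2 < t := hl t List.mem_cons_self
    simp only [List.map_cons, List.prod_cons]
    generalize (l.map transferMatrix).prod = M at *
    rw [M.eta_fin_two]
    simp [transferMatrix, Matrix.trace_fin_two]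
    nlinarith

/-- Negating all parameters conjugates the product by `diag(1, -1)`, up to sign. -/
lemma transferMatrix_prod_map_neg (l : List ℝ) :
    ((l.map Neg.neg).map transferMatrix).prod =
      (-1 : ℝ) ^ l.length • (!![1, 0; 0, -1] * (l.map transferMatrix).prod * !![1, 0; 0, -1]) := by
  induction l with
  | nil => simp [Matrix.one_fin_two]
  | cons t l ih =>
    simp only [List.map_cons, List.prod_cons, List.length_cons, ih]
    generalize (l.map transferMatrix).prod = M
    rw [M.eta_fin_two]
    ext i j
    fin_cases i <;> fin_cases j <;> simp [transferMatrix] <;> ring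

lemma abs_trace_transferMatrix_prod_map_neg (l : List ℝ) :
    |((l.map Neg.neg).map transferMatrix).prod.trace| = |(l.map transferMatrix).prod.trace| := by
  have hsq : (!![1, 0; 0, -1] * !![1, 0; 0, -1] : Matrix (Fin 2) (Fin 2) ℝ) = 1 := by
    simp [Matrix.one_fin_two]
  rw [transferMatrix_prod_map_neg, Matrix.trace_smul, Matrix.trace_mul_comm, ← mul_assoc, hsq,
    one_mul, smul_eq_mul, abs_mul, abs_neg_one_pow, one_mul]

/-- **Hierarchical band gaps of the coupled-pendulum chain (identical pendulums).**
If `ω² < ω₀²` or `ω² > ω₀² + 4κ/(min_i m_i)`, then the trace of the product of the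
per-site transfer matrices `P_i` (with rows (0, 1) and (−1, 2 − ω²m_i/κ + ω₀²m_i/κ))
exceeds 2 in absolute value. -/
theorem pendulum_hierarchical_gap (n : ℕ) (hn : 1 ≤ n) (m : Fin n → ℝ)
    (hm : ∀ i : Fin n, m i > 0) (κ : ℝ) (hκ : κ > 0) (ω₀ ω : ℝ)
    (hω : ω ^ 2 < ω₀ ^ 2 ∨
      ω ^ 2 > ω₀ ^ 2 + 4 * κ /
        (Finset.univ.inf' (Finset.univ_nonempty_iff.mpr (Fin.pos_iff_nonempty.mp hn)) m)) :
    |Matrix.trace ((List.ofFn fun i : Fin n =>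
        !![(0 : ℝ), 1; -1, 2 - ω ^ 2 * m i / κ + ω₀ ^ 2 * m i / κ]).prod)| > 2 := by
  set f : Fin n → ℝ := fun i => 2 - ω ^ 2 * m i / κ + ω₀ ^ 2 * m i / κ with hf
  have hne : List.ofFn f ≠ [] := by
    rw [Ne, List.ofFn_eq_nil_iff]
    lia
  have hprod : (List.ofFn fun i : Fin n =>
      !![(0 : ℝ), 1; -1, 2 - ω ^ 2 * m i / κ + ω₀ ^ 2 * m i / κ]) =
      (List.ofFn f).map transferMatrix := by
    rw [List.map_ofFn]
    rfl
  have hf' : ∀ i, f i = 2 + (ω₀ ^ 2 - ω ^ 2) * m i / κ := fun i => by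
    rw [hf]
    ring
  rw [hprod, gt_iff_lt]
  rcases hω with hlow | hhigh
  · refine (two_lt_trace_transferMatrix_prod _ hne ?_).trans_le (le_abs_self _)
    intro t ht
    obtain ⟨i, rfl⟩ := List.mem_ofFn.mp ht
    have : 0 < (ω₀ ^ 2 - ω ^ 2) * m i / κ :=
      div_pos (mul_pos (sub_pos.mpr hlow) (hm i)) hκ
    rw [hf']
    linarith
  · rw [← abs_trace_transferMatrix_prod_map_neg]
    refine (two_lt_trace_transferMatrix_prod _ (by simpa using hne) ?_).trans_le (le_abs_self _)
    intro t ht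
    obtain ⟨s, hs, rfl⟩ := List.mem_map.mp ht
    obtain ⟨i, rfl⟩ := List.mem_ofFn.mp hs
    have hmin : 0 < Finset.univ.inf'
        (Finset.univ_nonempty_iff.mpr (Fin.pos_iff_nonempty.mp hn)) m :=
      (Finset.lt_inf'_iff _).mpr fun j _ => hm j
    have hdiv : 4 * κ / m i ≤ 4 * κ / Finset.univ.inf'
        (Finset.univ_nonempty_iff.mpr (Fin.pos_iff_nonempty.mp hn)) m :=
      div_le_div_of_nonneg_left (by positivity) hmin (Finset.inf'_le _ (Finset.mem_univ i))
    have hgap : 4 * κ / m i < ω ^ 2 - ω₀ ^ 2 := by linarith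
    rw [div_lt_iff₀ (hm i)] at hgap
    have : 4 < (ω ^ 2 - ω₀ ^ 2) * m i / κ := (lt_div_iff₀ hκ).mpr hgap
    have hneg : (ω₀ ^ 2 - ω ^ 2) * m i / κ = -((ω ^ 2 - ω₀ ^ 2) * m i / κ) := by ring
    rw [hf', hneg]
    linarith
end

section
/- Let n ≥ 1, let m_1, …, m_n be positive reals, let κ > 0 and let ω_1, …, ω_n be real numbers (the pendulum eigenfrequencies). Suppose the real number ω satisfies, for every 1 ≤ i ≤ n, either ω² < ω_i² or ω² > ω_i² + 4κ/m_i. Let P_i be the 2×2 matrix with rows (0, 1) and (−1, 2 − ω²·m_i/κ + ω_i²·m_i/κ). Then |tr(∏_{i=1}^n P_i)| > 2. In particular this holds whenever 0 ≤ ω² < min_i ω_i², or whenever ω² > max_i (ω_i² + 4κ/m_i). -/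
/-- The transfer matrix `!![0, 1; -1, t]` of a single site. -/
def siteMatrix (t : ℝ) : Matrix (Fin 2) (Fin 2) ℝ := !![0, 1; -1, t]

/-- Left multiplication by `!![0, 1; -1, t]` sends the lower right entry `d`, with upper right
entry `b`, to `t * d - b`. -/
lemma abs_mul_sub_abs_le (t b d : ℝ) : |t| * |d| - |b| ≤ |t * d - b| := by
  simpa only [abs_mul] using abs_sub_abs_le_abs_sub (t * d) b

/-- In a product of site matrices with `2 ≤ |t|`, the lower right entry exceeds both off-diagonal
entries by at least one in absolute value. -/
lemma siteMatrix_prod_dominant (l : List ℝ) (hl : ∀ t ∈ l, 2 ≤ |t|) :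
    ((l.map siteMatrix).prod).det = 1 ∧
      |(l.map siteMatrix).prod 0 1| + 1 ≤ |(l.map siteMatrix).prod 1 1| ∧
      |(l.map siteMatrix).prod 1 0| + 1 ≤ |(l.map siteMatrix).prod 1 1| := by
  induction l with
  | nil => simp
  | cons t l ih =>
    obtain ⟨hdet, hb, hc⟩ := ih fun s hs => hl s (List.mem_cons_of_mem t hs)
    have ht := hl t List.mem_cons_self
    rw [List.map_cons, List.prod_cons]
    generalize (l.map siteMatrix).prod = M at *
    refine ⟨by rw [Matrix.det_mul, hdet]; simp [siteMatrix, Matrix.det_fin_two], ?_⟩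
    rw [Matrix.det_fin_two] at hdet
    simp only [siteMatrix, Matrix.mul_apply, Fin.sum_univ_two, Matrix.of_apply, Matrix.cons_val',
      Matrix.cons_val_zero, Matrix.cons_val_one, Matrix.cons_val_fin_one]
    generalize M 0 0 = a at *
    generalize M 0 1 = b at *
    generalize M 1 0 = c at *
    generalize M 1 1 = d at *
    rw [show 0 * b + 1 * d = d by ring, show -1 * b + t * d = t * d - b by ring,
      show -1 * a + t * c = t * c - a by ring]
    have hd : 0 < |d| := by linarith [abs_nonneg b]
    have hgrow : |d| + 1 ≤ |t * d - b| := by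
      nlinarith [abs_mul_sub_abs_le t b d]
    refine ⟨hgrow, ?_⟩
    have hcross : |t * c - a| * |d| ≤ |t * d - b| * |c| + 1 := by
      rw [← abs_mul, ← abs_mul,
        show (t * c - a) * d = (t * d - b) * c - 1 by linear_combination -hdet]
      simpa using abs_sub ((t * d - b) * c) 1
    refine le_of_mul_le_mul_right ?_ hd
    nlinarith [mul_le_mul_of_nonneg_left hc (abs_nonneg (t * d - b))]

/-- A nonempty product of hyperbolic site matrices is hyperbolic. -/
lemma two_lt_abs_trace_siteMatrix_prod (l : List ℝ) (hne : l ≠ []) (hl : ∀ t ∈ l, 2 < |t|) :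
    2 < |((l.map siteMatrix).prod).trace| := by
  obtain ⟨t, l, rfl⟩ := List.exists_cons_of_ne_nil hne
  obtain ⟨-, hb, hc⟩ := siteMatrix_prod_dominant l fun s hs =>
    (hl s (List.mem_cons_of_mem t hs)).le
  have ht := hl t List.mem_cons_self
  rw [List.map_cons, List.prod_cons]
  generalize (l.map siteMatrix).prod = M at *
  simp only [Matrix.trace_fin_two, siteMatrix, Matrix.mul_apply, Fin.sum_univ_two,
    Matrix.of_apply, Matrix.cons_val', Matrix.cons_val_zero, Matrix.cons_val_one,
    Matrix.cons_val_fin_one]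
  rw [show 0 * M 0 0 + 1 * M 1 0 + (-1 * M 0 1 + t * M 1 1)
    = (t * M 1 1 - M 0 1) - (-M 1 0) by ring]
  have htrace := abs_sub_abs_le_abs_sub (t * M 1 1 - M 0 1) (-M 1 0)
  rw [abs_neg] at htrace
  nlinarith [abs_mul_sub_abs_le t (M 0 1) (M 1 1), abs_nonneg (M 0 1)]

/-- **Hierarchical band gaps of the modulated coupled-pendulum chain.** If for every `i`
either `ω² < ω_i²` or `ω² > ω_i² + 4κ/m_i`, then the trace of the product of the
per-site transfer matrices `P_i` (with rows (0, 1) and (−1, 2 − ω²m_i/κ + ω_i²m_i/κ))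
exceeds 2 in absolute value. -/
theorem modulated_pendulum_hierarchical_gap (n : ℕ) (hn : 1 ≤ n) (m : Fin n → ℝ)
    (hm : ∀ i : Fin n, m i > 0) (κ : ℝ) (hκ : κ > 0) (ωi : Fin n → ℝ) (ω : ℝ)
    (hω : ∀ i : Fin n, ω ^ 2 < ωi i ^ 2 ∨ ω ^ 2 > ωi i ^ 2 + 4 * κ / m i) :
    |Matrix.trace ((List.ofFn fun i : Fin n =>
        !![(0 : ℝ), 1; -1, 2 - ω ^ 2 * m i / κ + ωi i ^ 2 * m i / κ]).prod)| > 2 := by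
  have hprod : (List.ofFn fun i : Fin n =>
        !![(0 : ℝ), 1; -1, 2 - ω ^ 2 * m i / κ + ωi i ^ 2 * m i / κ]) =
      (List.ofFn fun i : Fin n => 2 - ω ^ 2 * m i / κ + ωi i ^ 2 * m i / κ).map siteMatrix := by
    rw [List.map_ofFn]
    rfl
  rw [hprod]
  refine two_lt_abs_trace_siteMatrix_prod _ ?_ ?_
  · rw [Ne, List.ofFn_eq_nil_iff]
    lia
  · intro t ht
    obtain ⟨i, rfl⟩ := List.mem_ofFn.mp ht
    have hmi := hm i
    rw [show 2 - ω ^ 2 * m i / κ + ωi i ^ 2 * m i / κ = 2 - (ω ^ 2 - ωi i ^ 2) * m i / κ by ring,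
      lt_abs]
    rcases hω i with h | h
    · left
      have : (ω ^ 2 - ωi i ^ 2) * m i / κ < 0 :=
        div_neg_of_neg_of_pos (mul_neg_of_neg_of_pos (sub_neg.mpr h) hmi) hκ
      linarith
    · right
      have : 4 < (ω ^ 2 - ωi i ^ 2) * m i / κ := by
        rw [lt_div_iff₀ hκ, ← div_lt_iff₀ hmi]
        linarith
      linarith
end

section
/- Let n ≥ 1, let κ > 0, M ≥ 0, m ≥ 0, and let ω_1, …, ω_n be real resonant frequencies. Define for each i the effective-mass value M_i^eff(ω) = M + m·ω_i²/(ω_i² − ω²) and t_i(ω) = 2 − M_i^eff(ω)·ω²/κ. Suppose the real number ω satisfies ω² ≠ ω_i² and |t_i(ω)| > 2 for every 1 ≤ i ≤ n. Let Q_i be the 2×2 matrix with rows (0, 1) and (−1, t_i(ω)). Then |tr(∏_{i=1}^n Q_i)| > 2, i.e. ω lies in a band gap of the complex locally resonant phononic crystal. -/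
/-- The matrix `P` maps the double cone `|x| ≤ |y|` into itself; it is enough to say so for the
extreme rays `(1, 1)` and `(-1, 1)`, whose images lie in the same half `0 < s * y`. -/
def PreservesCone (P : Matrix (Fin 2) (Fin 2) ℝ) : Prop :=
  ∃ s : ℝ, 0 < s * (P 1 1 + P 1 0) ∧ 0 < s * (P 1 1 - P 1 0) ∧
    |s * (P 0 1 + P 0 0)| ≤ s * (P 1 1 + P 1 0) ∧
    |s * (P 0 1 - P 0 0)| ≤ s * (P 1 1 - P 1 0)

/-- As `PreservesCone`, with the image of the cone in its interior. -/
def StrictlyPreservesCone (P : Matrix (Fin 2) (Fin 2) ℝ) : Prop :=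
  ∃ s : ℝ, |s * (P 0 1 + P 0 0)| < s * (P 1 1 + P 1 0) ∧
    |s * (P 0 1 - P 0 0)| < s * (P 1 1 - P 1 0)

theorem StrictlyPreservesCone.preservesCone {P : Matrix (Fin 2) (Fin 2) ℝ}
    (h : StrictlyPreservesCone P) : PreservesCone P := by
  obtain ⟨s, h₁, h₂⟩ := h
  exact ⟨s, (abs_nonneg _).trans_lt h₁, (abs_nonneg _).trans_lt h₂, h₁.le, h₂.le⟩

theorem preservesCone_one : PreservesCone 1 :=
  ⟨1, by simp⟩

theorem PreservesCone.transferMatrix_mul {P : Matrix (Fin 2) (Fin 2) ℝ}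
    (h : PreservesCone P) {t : ℝ} (ht : 2 < |t|) :
    StrictlyPreservesCone (transferMatrix t * P) := by
  obtain ⟨s, hp, hm, h₁, h₂⟩ := h
  rw [abs_le] at h₁ h₂
  simp only [StrictlyPreservesCone, transferMatrix, Matrix.mul_apply, Fin.sum_univ_two,
    Matrix.of_apply, Matrix.cons_val_zero, Matrix.cons_val_one, Matrix.cons_val', abs_lt]
  rcases lt_abs.1 ht with ht | ht
  · refine ⟨s, ⟨?_, ?_⟩, ?_, ?_⟩ <;>
      nlinarith [mul_pos hp (sub_pos.2 ht), mul_pos hm (sub_pos.2 ht)]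
  · refine ⟨-s, ⟨?_, ?_⟩, ?_, ?_⟩ <;>
      nlinarith [mul_pos hp (sub_pos.2 ht), mul_pos hm (sub_pos.2 ht)]

theorem preservesCone_prod_transferMatrix (l : List ℝ) (hl : ∀ t ∈ l, 2 < |t|) :
    PreservesCone (l.map transferMatrix).prod := by
  induction l with
  | nil => simpa using preservesCone_one
  | cons t l ih =>
    rw [List.forall_mem_cons] at hl
    simpa using ((ih hl.2).transferMatrix_mul hl.1).preservesCone

theorem strictlyPreservesCone_prod_transferMatrix {l : List ℝ} (hne : l ≠ [])
    (hl : ∀ t ∈ l, 2 < |t|) : StrictlyPreservesCone (l.map transferMatrix).prod := by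
  cases l with
  | nil => exact absurd rfl hne
  | cons t l =>
    rw [List.forall_mem_cons] at hl
    simpa using (preservesCone_prod_transferMatrix l hl.2).transferMatrix_mul hl.1

theorem det_prod_transferMatrix (l : List ℝ) : (l.map transferMatrix).prod.det = 1 := by
  induction l with
  | nil => simp
  | cons t l ih =>
    rw [List.map_cons, List.prod_cons, Matrix.det_mul, ih, transferMatrix, Matrix.det_fin_two_of]
    norm_num

/-- The quadratic `P 0 1 + (P 0 0 - P 1 1) * r - P 1 0 * r ^ 2`, whose roots are the slopes of the
eigenvectors, changes sign on `[-1, 1]`, so its discriminant `tr P ^ 2 - 4` is positive. -/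
theorem StrictlyPreservesCone.two_lt_abs_trace {P : Matrix (Fin 2) (Fin 2) ℝ}
    (h : StrictlyPreservesCone P) (hdet : P.det = 1) : 2 < |P.trace| := by
  obtain ⟨s, h₁, h₂⟩ := h
  rw [Matrix.det_fin_two] at hdet
  rw [Matrix.trace_fin_two]
  rw [abs_lt] at h₁ h₂
  have hsign : 0 < s ^ 2 * ((P 1 1 - P 0 0) ^ 2 - (P 0 1 - P 1 0) ^ 2) := by
    have := mul_pos (sub_pos.2 h₁.2) (neg_lt_iff_pos_add.1 h₂.1)
    linarith
  have hdisc := pos_of_mul_pos_right hsign (sq_nonneg s)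
  have hsq : (2 : ℝ) ^ 2 < (P 0 0 + P 1 1) ^ 2 := by
    linarith [sq_nonneg (P 0 1 + P 1 0)]
  simpa using sq_lt_sq.1 hsq

/-- **Band gaps of the complex locally resonant phononic crystal.** With effective-mass
values `M_i^eff(ω) = M + m·ω_i²/(ω_i² − ω²)` and `t_i(ω) = 2 − M_i^eff(ω)·ω²/κ`, if
`ω² ≠ ω_i²` and `|t_i(ω)| > 2` for every `i`, then the trace of the product of the
per-site transfer matrices `Q_i` (with rows (0, 1) and (−1, t_i(ω))) exceeds 2 in
absolute value. -/
theorem phononic_hierarchical_gap (n : ℕ) (hn : 1 ≤ n) (κ : ℝ) (hκ : κ > 0)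
    (M m : ℝ) (hM : M ≥ 0) (hm : m ≥ 0) (ωi : Fin n → ℝ) (ω : ℝ)
    (hres : ∀ i : Fin n, ω ^ 2 ≠ ωi i ^ 2)
    (ht : ∀ i : Fin n,
      |2 - (M + m * ωi i ^ 2 / (ωi i ^ 2 - ω ^ 2)) * ω ^ 2 / κ| > 2) :
    |Matrix.trace ((List.ofFn fun i : Fin n =>
        !![(0 : ℝ), 1; -1, 2 - (M + m * ωi i ^ 2 / (ωi i ^ 2 - ω ^ 2)) * ω ^ 2 / κ]).prod)|
      > 2 := by
  let t : Fin n → ℝ := fun i => 2 - (M + m * ωi i ^ 2 / (ωi i ^ 2 - ω ^ 2)) * ω ^ 2 / κ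
  change 2 < |Matrix.trace (List.ofFn (transferMatrix ∘ t)).prod|
  rw [← List.map_ofFn]
  refine (strictlyPreservesCone_prod_transferMatrix ?_ ?_).two_lt_abs_trace
    (det_prod_transferMatrix _)
  · rw [Ne, List.ofFn_eq_nil_iff]
    omega
  · rw [List.forall_mem_ofFn_iff]
    exact ht
end

section
/- Let t_A and t_B be real numbers with |t_A| > 2 and |t_B| > 2, and define the Fibonacci sequence of matrices by F_1 = T(t_A), F_2 = T(t_B) and F_{k+2} = F_{k+1}·F_k for k ≥ 1. Then |tr F_k| > 2 for every k ≥ 1; i.e. the common band gaps of the two constituent elements persist as band gaps throughout the entire sequence of periodic Fibonacci tilings. -/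
/-- The trace identity `tr (M N M) = tr (M N) tr M - tr N` for `M` of determinant one. -/
lemma trace_mul_mul_self_of_det_eq_one {R : Type*} [CommRing R]
    (M N : Matrix (Fin 2) (Fin 2) R) (hM : M.det = 1) :
    (M * N * M).trace = (M * N).trace * M.trace - N.trace := by
  rw [Matrix.det_fin_two] at hM
  simp only [Matrix.trace_fin_two, Matrix.mul_apply, Fin.sum_univ_two]
  linear_combination (-N 0 0 - N 1 1) * hM

/-- If `|b| > 2`, `|c| > 2` and `|a| ≤ |c|`, then `c * b - a` dominates `2` and `|b|`. -/
lemma two_lt_abs_mul_sub_and_le {a b c : ℝ} (hb : 2 < |b|) (hc : 2 < |c|) (hac : |a| ≤ |c|) :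
    2 < |c * b - a| ∧ |b| ≤ |c * b - a| := by
  have h := abs_sub_abs_le_abs_sub (c * b) a
  rw [abs_mul] at h
  constructor <;> nlinarith [mul_pos (sub_pos.2 hb) (sub_pos.2 hc)]

/-- **Super band gaps of Fibonacci tilings.** If `|t_A| > 2` and `|t_B| > 2`, and the
matrices `F_k` satisfy the Fibonacci recursion `F_1 = T(t_A)`, `F_2 = T(t_B)`,
`F_{k+2} = F_{k+1}·F_k`, then `|tr F_k| > 2` for every `k ≥ 1`. -/
theorem fibonacci_super_band_gap (tA tB : ℝ) (hA : |tA| > 2) (hB : |tB| > 2)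
    (F : ℕ → Matrix (Fin 2) (Fin 2) ℝ)
    (hF1 : F 1 = T tA) (hF2 : F 2 = T tB)
    (hFrec : ∀ k : ℕ, 1 ≤ k → F (k + 2) = F (k + 1) * F k) :
    ∀ k : ℕ, 1 ≤ k → |Matrix.trace (F k)| > 2 := by
  have hdet : ∀ k, 1 ≤ k → (F k).det = 1 ∧ (F (k + 1)).det = 1 := by
    intro k hk
    induction k, hk using Nat.le_induction with
    | base => simp [hF1, hF2, T]
    | succ k hk ih => exact ⟨ih.2, by rw [hFrec k hk, Matrix.det_mul, ih.1, ih.2, one_mul]⟩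
  have key : ∀ k, 1 ≤ k → 2 < |(F k).trace| ∧ 2 < |(F (k + 1)).trace| ∧
      2 < |(F (k + 2)).trace| ∧ |(F k).trace| ≤ |(F (k + 2)).trace| := by
    intro k hk
    induction k, hk using Nat.le_induction with
    | base =>
      have h3 : (F 3).trace = tB * tA - 2 := by
        rw [hFrec 1 le_rfl, hF1, hF2]
        simp [T, Matrix.trace_fin_two]
        ring
      have h1 : (F 1).trace = tA := by simp [hF1, T, Matrix.trace_fin_two]
      have h2 : (F 2).trace = tB := by simp [hF2, T, Matrix.trace_fin_two]
      have h := two_lt_abs_mul_sub_and_le (a := 2) hA hB (by simpa using hB.le)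
      simpa only [Nat.reduceAdd, h1, h2, h3] using ⟨hA, hB, h⟩
    | succ k hk ih =>
      obtain ⟨-, hb, hc, hac⟩ := ih
      have h : (F (k + 3)).trace =
          (F (k + 2)).trace * (F (k + 1)).trace - (F k).trace := by
        rw [hFrec (k + 1) (by omega), hFrec k hk,
          trace_mul_mul_self_of_det_eq_one _ _ (hdet k hk).2]
      refine ⟨hb, hc, ?_⟩
      rw [show k + 1 + 2 = k + 3 from rfl, h]
      exact two_lt_abs_mul_sub_and_le hb hc hac
  exact fun k hk => (key k hk).1
end
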